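/- (First self-testing decomposition.) Let (ψ, (P_x^a), (Q_y^b)) be any finite-dimensional strategy inducing the ideal correlation p*. Then there exist k_A, k_B ≥ 1, isometries V_A : ℂ^{d_A} → ℂ²⊗ℂ^{k_A} and V_B : ℂ^{d_B} → ℂ²⊗ℂ^{k_B} (complex matrices with V_Aᴴ·V_A = I and V_Bᴴ·V_B = I), and a unit vector χ : Fin k_A × Fin k_B → ℂ such that, under the canonical identification (ℂ²⊗ℂ^{k_A})⊗(ℂ²⊗ℂ^{k_B}) ≅ (ℂ²⊗ℂ²)⊗(ℂ^{k_A}⊗ℂ^{k_B}): (V_A⊗V_B)ψ = (1/√(1+α²))·(|00⟩ + α|11⟩)⊗χ; (V_A⊗V_B)((P_0^0⊗I)ψ) = (1/√(1+α²))·|00⟩⊗χ; and (V_A⊗V_B)((P_0^1⊗I)ψ) = (α/√(1+α²))·|11⟩⊗χ. -/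

import Mathlib

open Matrix Kronecker

noncomputable section

namespace Sep

/-- Pauli `σz`. -/
def sz : Matrix (Fin 2) (Fin 2) ℝ := !![1, 0; 0, -1]

/-- Pauli `σx`. -/
def sx : Matrix (Fin 2) (Fin 2) ℝ := !![0, 1; 1, 0]

/-- `μ = arctan (sin 2θ)` where `θ = arctan α`. -/
def mu (α : ℝ) : ℝ := Real.arctan (Real.sin (2 * Real.arctan α))

/-- The tilted Pauli `σαz`. -/
def saz (α : ℝ) : Matrix (Fin 2) (Fin 2) ℝ :=
  Real.cos (mu α) • sz + Real.sin (mu α) • sx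

/-- The tilted Pauli `σαx`. -/
def sax (α : ℝ) : Matrix (Fin 2) (Fin 2) ℝ :=
  Real.cos (mu α) • sz - Real.sin (mu α) • sx

/-- Orthogonal projection onto the `+1`-eigenspace of a symmetric involution `O`
(with eigenvalues `+1` and `-1`): `O⁺ = (I + O)/2`. -/
def pl (O : Matrix (Fin 2) (Fin 2) ℝ) : Matrix (Fin 2) (Fin 2) ℝ := (2 : ℝ)⁻¹ • (1 + O)

/-- Orthogonal projection onto the `-1`-eigenspace: `O⁻ = (I - O)/2`. -/
def mn (O : Matrix (Fin 2) (Fin 2) ℝ) : Matrix (Fin 2) (Fin 2) ℝ := (2 : ℝ)⁻¹ • (1 - O)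

/-- Embed a `2×2` matrix `O` as an `ℕ×ℕ` matrix supported on rows/columns `f 0, f 1`,
with entry `O r s` at position `(f r, f s)`. -/
def embed (f : Fin 2 → ℕ) (O : Matrix (Fin 2) (Fin 2) ℝ) : Matrix ℕ ℕ ℝ :=
  fun i j => ∑ r : Fin 2, ∑ s : Fin 2, if i = f r ∧ j = f s then O r s else 0

/-- `ev_m(O)`: supported on `{2m, 2m+1}`. -/
def evm (m : ℕ) (O : Matrix (Fin 2) (Fin 2) ℝ) : Matrix ℕ ℕ ℝ :=
  embed (fun r => 2 * m + (r : ℕ)) O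

/-- `od_m(O)`: supported on `{2m+1, 2m+2}`. -/
def odm (m : ℕ) (O : Matrix (Fin 2) (Fin 2) ℝ) : Matrix ℕ ℕ ℝ :=
  embed (fun r => 2 * m + 1 + (r : ℕ)) O

/-- Entrywise sum `Σ_m F m` of a family of `ℕ×ℕ` matrices. -/
def sumB (F : ℕ → Matrix ℕ ℕ ℝ) : Matrix ℕ ℕ ℝ := fun i j => ∑' m, F m i j

/-- The `ℕ×ℕ` matrix with a single `1` entry at `(0,0)`. -/
def E00 : Matrix ℕ ℕ ℝ := fun i j => if i = 0 ∧ j = 0 then 1 else 0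

/-- Alice's ideal operators `A_x^a`. -/
def Aop : Fin 4 → Fin 3 → Matrix ℕ ℕ ℝ :=
  ![![sumB (fun m => evm m (pl sz)), sumB (fun m => evm m (mn sz)), 0],
    ![sumB (fun m => evm m (pl sx)), sumB (fun m => evm m (mn sx)), 0],
    ![sumB (fun m => odm m (mn sz)), sumB (fun m => odm m (pl sz)), E00],
    ![sumB (fun m => odm m (mn sx)), sumB (fun m => odm m (pl sx)), E00]]

/-- Bob's ideal operators `B_y^b`. -/
def Bop (α : ℝ) : Fin 5 → Fin 3 → Matrix ℕ ℕ ℝ :=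
  ![![sumB (fun m => evm m (pl (saz α))), sumB (fun m => evm m (mn (saz α))), 0],
    ![sumB (fun m => evm m (pl (sax α))), sumB (fun m => evm m (mn (sax α))), 0],
    ![sumB (fun m => odm m (mn (saz α))), sumB (fun m => odm m (pl (saz α))), E00],
    ![sumB (fun m => odm m (mn (sax α))), sumB (fun m => odm m (pl (sax α))), E00],
    ![Aop 0 0, Aop 0 1, Aop 0 2]]

/-- The ideal correlation `p*(a,b|x,y) = (1-α²) Σ_{i,k} α^{i+k} A_x^a(i,k) B_y^b(i,k)`. -/
def pstar (α : ℝ) (x : Fin 4) (y : Fin 5) (a b : Fin 3) : ℝ :=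
  (1 - α ^ 2) * ∑' ik : ℕ × ℕ, α ^ (ik.1 + ik.2) * Aop x a ik.1 ik.2 * Bop α y b ik.1 ik.2

/-- A finite-dimensional strategy on question sets `Fin 4`, `Fin 5` and
answer sets `Fin 3`, `Fin 3`. -/
structure Strategy (dA dB : ℕ) where
  ψ : Fin dA × Fin dB → ℂ
  P : Fin 4 → Fin 3 → Matrix (Fin dA) (Fin dA) ℂ
  Q : Fin 5 → Fin 3 → Matrix (Fin dB) (Fin dB) ℂ
  unit : ∑ p : Fin dA × Fin dB, Complex.normSq (ψ p) = 1
  P_sa : ∀ x a, (P x a)ᴴ = P x a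
  P_proj : ∀ x a, P x a * P x a = P x a
  P_complete : ∀ x, ∑ a, P x a = 1
  Q_sa : ∀ y b, (Q y b)ᴴ = Q y b
  Q_proj : ∀ y b, Q y b * Q y b = Q y b
  Q_complete : ∀ y, ∑ b, Q y b = 1

/-- Action of `P ⊗ I` on a bipartite vector. -/
def actA {dA dB : ℕ} (P : Matrix (Fin dA) (Fin dA) ℂ) (ψ : Fin dA × Fin dB → ℂ) :
    Fin dA × Fin dB → ℂ := fun p => ∑ k, P p.1 k * ψ (k, p.2)

/-- Action of `I ⊗ Q` on a bipartite vector. -/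
def actB {dA dB : ℕ} (Q : Matrix (Fin dB) (Fin dB) ℂ) (ψ : Fin dA × Fin dB → ℂ) :
    Fin dA × Fin dB → ℂ := fun p => ∑ l, Q p.2 l * ψ (p.1, l)

/-- The correlation induced by a strategy: `⟨ψ, (P_x^a ⊗ Q_y^b) ψ⟩`. -/
def induced {dA dB : ℕ} (S : Strategy dA dB) (x : Fin 4) (y : Fin 5) (a b : Fin 3) : ℂ :=
  ∑ p : Fin dA × Fin dB, (starRingEnd ℂ) (S.ψ p) * actA (S.P x a) (actB (S.Q y b) S.ψ) p

/-- If the observables `A₀, A₁` and `B₀, B₁` attain on `ψ` the correlations of the tilted CHSH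
optimum, then `B₀ - B₁` acts, up to the factor `2σ`, as a flip matching `A₁`. -/
theorem tilted_chsh_rigidity {E : Type*} [AddCommGroup E] [Module ℝ E]
    (F : LinearMap.BilinForm ℝ E) (hsymm : ∀ u v, F u v = F v u) (hpos : ∀ v, 0 ≤ F v v)
    (hdef : ∀ v, F v v = 0 → v = 0)
    (A₀ A₁ B₀ B₁ : E →ₗ[ℝ] E)
    (sA₀ : ∀ u v, F (A₀ u) v = F u (A₀ v)) (sA₁ : ∀ u v, F (A₁ u) v = F u (A₁ v))
    (sB₀ : ∀ u v, F (B₀ u) v = F u (B₀ v)) (sB₁ : ∀ u v, F (B₁ u) v = F u (B₁ v))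
    (iA₀ : ∀ v, A₀ (A₀ v) = v) (iA₁ : ∀ v, A₁ (A₁ v) = v)
    (iB₀ : ∀ v, B₀ (B₀ v) = v) (iB₁ : ∀ v, B₁ (B₁ v) = v)
    (c₀₀ : ∀ v, A₀ (B₀ v) = B₀ (A₀ v)) (c₀₁ : ∀ v, A₀ (B₁ v) = B₁ (A₀ v))
    (c₁₀ : ∀ v, A₁ (B₀ v) = B₀ (A₁ v)) (c₁₁ : ∀ v, A₁ (B₁ v) = B₁ (A₁ v))
    (ψ : E) {α γ σ S C : ℝ} (hσ : σ = γ * S) (hγ : 0 < γ) (hγσ : γ ^ 2 + σ ^ 2 = 1)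
    (hS : 0 < S) (hSC : S ^ 2 + C ^ 2 = 1) (hα : 1 - C = α * S)
    (h1 : F ψ ψ = 1)
    (h00 : F ψ (A₀ (B₀ ψ)) = γ) (h01 : F ψ (A₀ (B₁ ψ)) = γ)
    (h10 : F ψ (A₁ (B₀ ψ)) = S * σ) (h11 : F ψ (A₁ (B₁ ψ)) = -(S * σ))
    (hb0 : F ψ (B₀ ψ) = γ * C) (hb1 : F ψ (B₁ ψ) = γ * C) :
    (B₀ - B₁) ((B₀ - B₁) (ψ - A₀ ψ)) = (4 * σ ^ 2) • (ψ - A₀ ψ) ∧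
    A₁ ((B₀ - B₁) (ψ - A₀ ψ)) = (2 * σ * α) • (ψ + A₀ ψ) := by
  have e1 : F (B₀ ψ) (B₀ ψ) = 1 := by rw [sB₀, iB₀, h1]
  have e2 : F (B₁ ψ) (B₁ ψ) = 1 := by rw [sB₁, iB₁, h1]
  have e3 : F (A₀ ψ) (A₀ ψ) = 1 := by rw [sA₀, iA₀, h1]
  have e4 : F (A₁ (B₀ ψ)) (A₁ (B₀ ψ)) = 1 := by rw [sA₁, iA₁, e1]
  have e5 : F (A₁ (B₁ ψ)) (A₁ (B₁ ψ)) = 1 := by rw [sA₁, iA₁, e2]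
  have e6 : F (A₁ (B₀ ψ)) (A₁ (B₁ ψ)) = F (B₀ ψ) (B₁ ψ) := by rw [sA₁, iA₁]
  have e7 : F (A₁ (B₀ ψ)) (B₀ ψ) = F ψ (A₁ ψ) := by
    rw [c₁₀, sB₀, iB₀, hsymm]
  have e8 : F (A₁ (B₁ ψ)) (B₁ ψ) = F ψ (A₁ ψ) := by
    rw [c₁₁, sB₁, iB₁, hsymm]
  have e9 : F (A₁ (B₁ ψ)) (B₀ ψ) = F (A₁ (B₀ ψ)) (B₁ ψ) := by
    rw [sA₁, hsymm]
  have e10 : F (A₀ ψ) (B₀ ψ) = γ := by rw [sA₀, h00]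
  have e11 : F (A₀ ψ) (B₁ ψ) = γ := by rw [sA₀, h01]
  have s1 := hsymm (B₁ ψ) (B₀ ψ)
  have s2 := hsymm (A₁ (B₁ ψ)) (A₁ (B₀ ψ))
  have s3 := hsymm (B₀ ψ) ψ
  have s4 := hsymm (B₁ ψ) ψ
  have s5 := hsymm (A₁ (B₀ ψ)) ψ
  have s6 := hsymm (A₁ (B₁ ψ)) ψ
  have s7 := hsymm (B₀ ψ) (A₁ (B₀ ψ))
  have s8 := hsymm (B₁ ψ) (A₁ (B₀ ψ))
  have s9 := hsymm (B₀ ψ) (A₁ (B₁ ψ))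
  have s10 := hsymm (B₁ ψ) (A₁ (B₁ ψ))
  have s11 := hsymm (B₀ ψ) (A₀ ψ)
  have s12 := hsymm (B₁ ψ) (A₀ ψ)
  obtain ⟨w, hw⟩ : ∃ w, w = A₁ (B₀ ψ) - A₁ (B₁ ψ) - (2 * γ) • ψ + C • (B₀ ψ + B₁ ψ) := ⟨_, rfl⟩
  obtain ⟨d, hd⟩ : ∃ d, d = B₀ ψ + B₁ ψ - (2 * γ) • A₀ ψ := ⟨_, rfl⟩
  have hww : F w w = 4 - 4 * γ ^ 2 - S ^ 2 * (2 + 2 * F (B₀ ψ) (B₁ ψ)) := by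
    rw [hw]
    simp only [map_add, map_sub, map_smul, LinearMap.add_apply, LinearMap.sub_apply,
      LinearMap.smul_apply, smul_eq_mul, s1, s2, s3, s4, s5, s6, s7, s8, s9, s10,
      e1, e2, e4, e5, e6, e7, e8, e9, h1, h10, h11, hb0, hb1]
    rw [hσ]
    have : C ^ 2 = 1 - S ^ 2 := by linarith
    linear_combination (2 * F (B₀ ψ) (B₁ ψ) + 2 - 8 * γ ^ 2) * this
  have hdd : F d d = 2 + 2 * F (B₀ ψ) (B₁ ψ) - 4 * γ ^ 2 := by
    rw [hd]
    simp only [map_add, map_sub, map_smul, LinearMap.add_apply, LinearMap.sub_apply,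
      LinearMap.smul_apply, smul_eq_mul, s1, s11, s12, e1, e2, e3, e10, e11]
    ring
  have hsum : F w w + S ^ 2 * F d d = 0 := by
    rw [hww, hdd]
    rw [hσ] at hγσ
    linear_combination (-4) * hγσ
  have hd' := mul_nonneg (sq_nonneg S) (hpos d)
  have hw0 : w = 0 := hdef _ (by linarith [hpos w])
  have hd0 : d = 0 := by
    have : S ^ 2 * F d d = 0 := by linarith [hpos w]
    exact hdef _ ((mul_eq_zero.1 this).resolve_left (by positivity))
  have hL : B₀ ψ + B₁ ψ = (2 * γ) • A₀ ψ := sub_eq_zero.1 (hd ▸ hd0)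
  have hk : A₁ (B₀ ψ) - A₁ (B₁ ψ) = (2 * γ) • ψ - (2 * γ * C) • A₀ ψ := by
    have : A₁ (B₀ ψ) - A₁ (B₁ ψ) = w + (2 * γ) • ψ - C • (B₀ ψ + B₁ ψ) := by
      rw [hw]; abel
    rw [this, hw0, hL, smul_smul, zero_add, mul_comm C]
  have hLA : B₀ (A₀ ψ) + B₁ (A₀ ψ) = (2 * γ) • ψ := by
    rw [← c₀₀, ← c₀₁, ← map_add, hL, map_smul, iA₀]
  have hKA : (2 * γ) • (B₀ (A₀ ψ) - B₁ (A₀ ψ)) = B₀ (B₁ ψ) - B₁ (B₀ ψ) := by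
    have h := congrArg (fun v => B₀ v - B₁ v) hL
    simp only [map_add, map_smul, iB₀, iB₁, ← smul_sub] at h
    rw [← h]; abel
  have hLL : B₀ (B₁ ψ) + B₁ (B₀ ψ) = (4 * γ ^ 2 - 2) • ψ := by
    have h := congrArg (fun v => B₀ v + B₁ v) hL
    simp only [map_add, map_smul, iB₀, iB₁, ← smul_add, hLA, smul_smul] at h
    have : B₀ (B₁ ψ) + B₁ (B₀ ψ) = (2 * γ * (2 * γ)) • ψ - (2 : ℝ) • ψ := by
      rw [← h, two_smul]; abel
    rw [this, ← sub_smul]; congr 1; ring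
  have hKK : (B₀ - B₁) ((B₀ - B₁) ψ) = (4 * σ ^ 2) • ψ := by
    have : (B₀ - B₁) ((B₀ - B₁) ψ) = (2 : ℝ) • ψ - (B₀ (B₁ ψ) + B₁ (B₀ ψ)) := by
      simp only [LinearMap.sub_apply, map_sub, iB₀, iB₁, two_smul]; abel
    rw [this, hLL, ← sub_smul]; congr 1; linear_combination (-4) * hγσ
  constructor
  · have : (B₀ - B₁) ((B₀ - B₁) (A₀ ψ)) = A₀ ((B₀ - B₁) ((B₀ - B₁) ψ)) := by
      simp only [LinearMap.sub_apply, map_sub, c₀₀, c₀₁]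
    rw [map_sub, map_sub, this, hKK, map_smul, smul_sub]
  · have hkA : (2 * γ) • A₁ ((B₀ - B₁) (A₀ ψ))
        = - ((2 * γ) • ((2 * γ) • A₀ ψ - (2 * γ * C) • ψ)) := by
      rw [← map_smul, LinearMap.sub_apply, hKA]
      have h := congrArg (fun v => B₀ v + B₁ v) hk
      simp only [map_sub, map_smul, c₁₀, c₁₁, iB₀, iB₁] at h
      have h2 : A₁ (B₀ (B₁ ψ) - B₁ (B₀ ψ)) = - ((2 * γ) • (B₀ ψ + B₁ ψ)
          - (2 * γ * C) • (B₀ (A₀ ψ) + B₁ (A₀ ψ))) := by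
        rw [map_sub, c₁₀, c₁₁, c₁₁, c₁₀, smul_add, smul_add, ← neg_eq_iff_eq_neg]
        rw [add_sub_add_comm, ← h]; abel
      rw [h2, hL, hLA]; module
    have hkA' : A₁ ((B₀ - B₁) (A₀ ψ)) = - ((2 * γ) • A₀ ψ - (2 * γ * C) • ψ) := by
      rw [← smul_neg] at hkA
      exact smul_right_injective E (by positivity : (2 * γ) ≠ 0) hkA
    rw [map_sub, map_sub, hkA', LinearMap.sub_apply, map_sub, hk, hσ]
    have : 2 * (γ * S) * α = 2 * γ * (1 - C) := by rw [hα]; ring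
    rw [this]; module

/-- The sign of a self-adjoint matrix is a unitary which differs from the matrix only where its
square is not the identity. -/
theorem exists_sign_matrix {n : ℕ} (H : Matrix (Fin n) (Fin n) ℂ) (hH : Hᴴ = H) :
    ∃ U G : Matrix (Fin n) (Fin n) ℂ, Uᴴ * U = 1 ∧ U - H = G * (1 - H * H) := by
  have hsa : IsSelfAdjoint H := hH
  have hc : ∀ f : ℝ → ℝ, ContinuousOn f (spectrum ℝ H) := fun f =>
    (Matrix.finite_real_spectrum (A := H)).continuousOn f
  set s : ℝ → ℝ := fun x => if 0 ≤ x then 1 else -1 with hs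
  refine ⟨cfc s H, cfc (fun x => s x / (1 + |x|)) H, ?_, ?_⟩
  · have h1 : (cfc s H)ᴴ = cfc s H := (cfc_predicate s H : IsSelfAdjoint _)
    rw [h1, ← cfc_mul s s H (hc _) (hc _), ← cfc_const_one ℝ H]
    congr 1
    ext x
    simp only [hs]
    split_ifs <;> norm_num
  · have h2 : 1 - H * H = cfc (fun x : ℝ => 1 - x * x) H := by
      rw [cfc_sub _ _ H (hc _) (hc _), cfc_const_one ℝ H, cfc_mul _ _ H (hc _) (hc _),
        cfc_id' ℝ H hsa]
    have h3 : cfc s H - H = cfc (fun x => s x - x) H := by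
      rw [cfc_sub _ _ H (hc _) (hc _), cfc_id' ℝ H hsa]
    rw [h2, h3, ← cfc_mul _ _ H (hc _) (hc _)]
    congr 1
    ext x
    have : 0 < 1 + |x| := by positivity
    simp only [hs]
    split_ifs with hx
    · rw [abs_of_nonneg hx] at *; field_simp; ring
    · rw [abs_of_neg (not_le.1 hx)] at *; field_simp; ring

theorem sumB_embed_apply {f : ℕ → Fin 2 → ℕ}
    (hf : ∀ m n r s, f m r = f n s → m = n ∧ r = s) (O : Matrix (Fin 2) (Fin 2) ℝ)
    (m n : ℕ) (r s : Fin 2) :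
    sumB (fun m => embed (f m) O) (f m r) (f n s) = if m = n then O r s else 0 := by
  have hterm : ∀ k, embed (f k) O (f m r) (f n s) = if m = k ∧ n = k then O r s else 0 := by
    intro k
    have hiff : ∀ m k r s, f m r = f k s ↔ m = k ∧ r = s := fun m k r s =>
      ⟨hf m k r s, by rintro ⟨rfl, rfl⟩; rfl⟩
    unfold embed
    simp only [hiff]
    rw [Finset.sum_eq_single r, Finset.sum_eq_single s]
    · simp
    · intro b _ hb; rw [if_neg]; tauto
    · simp
    · intro b _ hb; refine Finset.sum_eq_zero fun c _ => ?_; rw [if_neg]; tauto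
    · simp
  unfold sumB
  simp only [hterm]
  split_ifs with h
  · subst h
    rw [tsum_eq_single m]
    · simp
    · intro k hk; rw [if_neg]; tauto
  · convert tsum_zero with k
    rw [if_neg]; rintro ⟨rfl, rfl⟩; exact h rfl

theorem sumB_evm_apply (O : Matrix (Fin 2) (Fin 2) ℝ) (m n : ℕ) (r s : Fin 2) :
    sumB (fun m => evm m O) (2 * m + r) (2 * n + s) = if m = n then O r s else 0 :=
  sumB_embed_apply (f := fun m r => 2 * m + (r : ℕ))
    (fun m n r s h => by constructor <;> omega) O m n r s

/-- The correlation of two even block-diagonal operators is that of the blocks in the state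
`|00⟩ + α|11⟩`. -/
theorem tsum_sumB_evm {α : ℝ} (hα0 : 0 < α) (hα1 : α < 1) (M N : Matrix (Fin 2) (Fin 2) ℝ) :
    (1 - α ^ 2) * ∑' ik : ℕ × ℕ, α ^ (ik.1 + ik.2) * sumB (fun m => evm m M) ik.1 ik.2 *
      sumB (fun m => evm m N) ik.1 ik.2 =
    (M 0 0 * N 0 0 + α * (M 0 1 * N 0 1 + M 1 0 * N 1 0) + α ^ 2 * (M 1 1 * N 1 1))
      / (1 + α ^ 2) := by
  let g : ℕ × Fin 2 × Fin 2 → ℕ × ℕ := fun p => (2 * p.1 + p.2.1, 2 * p.1 + p.2.2)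
  have hg : Function.Injective g := by
    rintro ⟨m, r, s⟩ ⟨n, r', s'⟩ h
    simp only [g, Prod.mk.injEq] at h ⊢
    refine ⟨?_, ?_, ?_⟩ <;> omega
  have hsupp : Function.support (fun ik : ℕ × ℕ => α ^ (ik.1 + ik.2) *
      sumB (fun m => evm m M) ik.1 ik.2 * sumB (fun m => evm m N) ik.1 ik.2) ⊆ Set.range g := by
    rintro ⟨i, k⟩ hik
    have key : ∀ i : ℕ, ∃ (m : ℕ) (r : Fin 2), i = 2 * m + r := fun i =>
      ⟨i / 2, ⟨i % 2, Nat.mod_lt _ two_pos⟩, by simp only; omega⟩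
    obtain ⟨m, r, rfl⟩ := key i
    obtain ⟨n, s, rfl⟩ := key k
    simp only [Function.mem_support, sumB_evm_apply] at hik
    by_cases hmn : m = n
    · subst hmn; exact ⟨(m, r, s), rfl⟩
    · simp [hmn] at hik
  rw [← hg.tsum_eq hsupp]
  have h4 : α ^ 4 < 1 := pow_lt_one₀ hα0.le hα1 (by norm_num)
  have h4' : 0 ≤ α ^ 4 := by positivity
  have hterm : ∀ p : ℕ × Fin 2 × Fin 2, α ^ ((g p).1 + (g p).2) *
      sumB (fun m => evm m M) (g p).1 (g p).2 * sumB (fun m => evm m N) (g p).1 (g p).2 =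
      (α ^ 4) ^ p.1 * (α ^ ((p.2.1 : ℕ) + (p.2.2 : ℕ)) * M p.2.1 p.2.2 * N p.2.1 p.2.2) := by
    rintro ⟨m, r, s⟩
    simp only [g, sumB_evm_apply, if_true]
    rw [← pow_mul]
    rw [show 2 * m + (r : ℕ) + (2 * m + (s : ℕ)) = 4 * m + (r + s) by ring, pow_add]
    ring
  simp only [hterm]
  rw [← tsum_mul_tsum_of_summable_norm (f := fun m : ℕ => (α ^ 4) ^ m)
    (g := fun q : Fin 2 × Fin 2 => α ^ ((q.1 : ℕ) + (q.2 : ℕ)) * M q.1 q.2 * N q.1 q.2)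
    (summable_geometric_of_lt_one h4' h4).norm (Summable.of_finite),
    tsum_geometric_of_lt_one h4' h4, tsum_fintype, Fintype.sum_prod_type]
  simp only [Fin.sum_univ_two, Fin.val_zero, Fin.val_one]
  have : 1 - α ^ 4 ≠ 0 := by linarith
  have : 1 + α ^ 2 ≠ 0 := by positivity
  field_simp
  ring

/-- Double angle form of the tilted CHSH angle. -/
theorem sin_mu_eq (α : ℝ) :
    Real.sin (mu α) = Real.cos (mu α) * (2 * α / (1 + α ^ 2)) := by
  have h : Real.tan (mu α) = 2 * α / (1 + α ^ 2) := by
    unfold mu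
    rw [Real.tan_arctan, Real.sin_two_mul, Real.sin_arctan, Real.cos_arctan]
    have h0 : (0 : ℝ) < 1 + α ^ 2 := by positivity
    have := Real.sq_sqrt h0.le
    have := Real.sqrt_pos.2 h0
    field_simp
    rw [Real.sq_sqrt h0.le]
  have hc : Real.cos (mu α) ≠ 0 := (Real.cos_arctan_pos _).ne'
  rw [← h, mul_comm, Real.tan_mul_cos hc]

theorem pstar_zero_zero {α : ℝ} (hα0 : 0 < α) (hα1 : α < 1) :
    pstar α 0 0 0 0 = (1 + Real.cos (mu α)) / 2 / (1 + α ^ 2) ∧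
    pstar α 0 0 0 1 = (1 - Real.cos (mu α)) / 2 / (1 + α ^ 2) ∧
    pstar α 0 0 1 0 = α ^ 2 * ((1 - Real.cos (mu α)) / 2) / (1 + α ^ 2) := by
  refine ⟨?_, ?_, ?_⟩ <;> refine (tsum_sumB_evm hα0 hα1 _ _).trans ?_ <;> congr 1 <;>
    simp only [pl, mn, sz, saz, sx, Matrix.smul_apply, Matrix.add_apply, Matrix.sub_apply,
      Matrix.one_apply, Matrix.of_apply, Matrix.cons_val', Matrix.cons_val_zero,
      Matrix.cons_val_one, Matrix.cons_val_fin_one, smul_eq_mul, Fin.isValue, Fin.reduceEq,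
      if_true, if_false] <;> ring

theorem pstar_zero_one {α : ℝ} (hα0 : 0 < α) (hα1 : α < 1) :
    pstar α 0 1 0 0 = (1 + Real.cos (mu α)) / 2 / (1 + α ^ 2) ∧
    pstar α 0 1 0 1 = (1 - Real.cos (mu α)) / 2 / (1 + α ^ 2) ∧
    pstar α 0 1 1 0 = α ^ 2 * ((1 - Real.cos (mu α)) / 2) / (1 + α ^ 2) := by
  refine ⟨?_, ?_, ?_⟩ <;> refine (tsum_sumB_evm hα0 hα1 _ _).trans ?_ <;> congr 1 <;>
    simp only [pl, mn, sz, sax, sx, Matrix.smul_apply, Matrix.add_apply, Matrix.sub_apply,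
      Matrix.one_apply, Matrix.of_apply, Matrix.cons_val', Matrix.cons_val_zero,
      Matrix.cons_val_one, Matrix.cons_val_fin_one, smul_eq_mul, Fin.isValue, Fin.reduceEq,
      if_true, if_false] <;> ring

theorem pstar_one_zero {α : ℝ} (hα0 : 0 < α) (hα1 : α < 1) :
    pstar α 1 0 0 1 = ((1 - Real.cos (mu α)) + α ^ 2 * (1 + Real.cos (mu α))
      - 2 * α * Real.sin (mu α)) / 4 / (1 + α ^ 2) ∧
    pstar α 1 0 1 0 = ((1 + Real.cos (mu α)) + α ^ 2 * (1 - Real.cos (mu α))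
      - 2 * α * Real.sin (mu α)) / 4 / (1 + α ^ 2) := by
  refine ⟨?_, ?_⟩ <;> refine (tsum_sumB_evm hα0 hα1 _ _).trans ?_ <;> congr 1 <;>
    simp only [pl, mn, sz, saz, sx, Matrix.smul_apply, Matrix.add_apply, Matrix.sub_apply,
      Matrix.one_apply, Matrix.of_apply, Matrix.cons_val', Matrix.cons_val_zero,
      Matrix.cons_val_one, Matrix.cons_val_fin_one, smul_eq_mul, Fin.isValue, Fin.reduceEq,
      if_true, if_false] <;> ring

theorem pstar_one_one {α : ℝ} (hα0 : 0 < α) (hα1 : α < 1) :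
    pstar α 1 1 0 1 = ((1 - Real.cos (mu α)) + α ^ 2 * (1 + Real.cos (mu α))
      + 2 * α * Real.sin (mu α)) / 4 / (1 + α ^ 2) ∧
    pstar α 1 1 1 0 = ((1 + Real.cos (mu α)) + α ^ 2 * (1 - Real.cos (mu α))
      + 2 * α * Real.sin (mu α)) / 4 / (1 + α ^ 2) := by
  refine ⟨?_, ?_⟩ <;> refine (tsum_sumB_evm hα0 hα1 _ _).trans ?_ <;> congr 1 <;>
    simp only [pl, mn, sz, sax, sx, Matrix.smul_apply, Matrix.add_apply, Matrix.sub_apply,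
      Matrix.one_apply, Matrix.of_apply, Matrix.cons_val', Matrix.cons_val_zero,
      Matrix.cons_val_one, Matrix.cons_val_fin_one, smul_eq_mul, Fin.isValue, Fin.reduceEq,
      if_true, if_false] <;> ring

theorem pstar_zero_four {α : ℝ} (hα0 : 0 < α) (hα1 : α < 1) :
    pstar α 0 4 0 0 = 1 / (1 + α ^ 2) ∧ pstar α 0 4 0 1 = 0 ∧ pstar α 0 4 1 0 = 0 := by
  refine ⟨?_, ?_, ?_⟩ <;> refine (tsum_sumB_evm hα0 hα1 _ _).trans ?_ <;>
    norm_num [pl, mn, sz]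

theorem pstar_two_left (α : ℝ) (y : Fin 5) (b : Fin 3) {x : Fin 4} (hx : x = 0 ∨ x = 1) :
    pstar α x y 2 b = 0 := by
  have h : Aop x 2 = 0 := by rcases hx with rfl | rfl <;> rfl
  simp only [pstar, h, Matrix.zero_apply, mul_zero, zero_mul, tsum_zero]

theorem pstar_two_right (α : ℝ) (x : Fin 4) (a : Fin 3) {y : Fin 5}
    (hy : y = 0 ∨ y = 1 ∨ y = 4) : pstar α x y a 2 = 0 := by
  have h : Bop α y 2 = 0 := by rcases hy with rfl | rfl | rfl <;> rfl
  simp only [pstar, h, Matrix.zero_apply, mul_zero, tsum_zero]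

section Expectation

variable {ι : Type*} [Fintype ι]

/-- The real part of the standard inner product on `ι → ℂ`. -/
def reInner (ι : Type*) [Fintype ι] : LinearMap.BilinForm ℝ (ι → ℂ) :=
  LinearMap.mk₂ ℝ (fun u v => (star u ⬝ᵥ v).re)
    (fun u v w => by simp [add_dotProduct]) (fun c u v => by simp [smul_dotProduct])
    (fun u v w => by simp [dotProduct_add]) (fun c u v => by simp [dotProduct_smul])

theorem reInner_apply (u v : ι → ℂ) : reInner ι u v = (star u ⬝ᵥ v).re := rfl

theorem reInner_comm (u v : ι → ℂ) : reInner ι u v = reInner ι v u := by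
  rw [reInner_apply, reInner_apply, star_dotProduct, Complex.star_def, Complex.conj_re]

theorem reInner_self (v : ι → ℂ) : reInner ι v v = ∑ i, Complex.normSq (v i) := by
  rw [reInner_apply, dotProduct, Complex.re_sum]
  refine Finset.sum_congr rfl fun i _ => ?_
  rw [Pi.star_apply, Complex.star_def, Complex.normSq_eq_conj_mul_self.symm, Complex.ofReal_re]

theorem reInner_self_nonneg (v : ι → ℂ) : 0 ≤ reInner ι v v := by
  rw [reInner_self]
  exact Finset.sum_nonneg fun i _ => Complex.normSq_nonneg _

theorem eq_zero_of_reInner_self {v : ι → ℂ} (h : reInner ι v v = 0) : v = 0 := by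
  rw [reInner_self, Finset.sum_eq_zero_iff_of_nonneg fun i _ => Complex.normSq_nonneg _] at h
  exact funext fun i => Complex.normSq_eq_zero.1 (h i (Finset.mem_univ i))

theorem reInner_mulVec {M : Matrix ι ι ℂ} (hM : Mᴴ = M) (u v : ι → ℂ) :
    reInner ι (M *ᵥ u) v = reInner ι u (M *ᵥ v) := by
  rw [reInner_apply, reInner_apply, star_mulVec, hM, ← dotProduct_mulVec]

/-- The real part of the expectation value of a matrix in the vector `ψ`. -/
def expect (ψ : ι → ℂ) : Matrix ι ι ℂ →ₗ[ℝ] ℝ where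
  toFun M := reInner ι ψ (M *ᵥ ψ)
  map_add' M N := by rw [add_mulVec, map_add]
  map_smul' c M := by rw [smul_mulVec, map_smul, RingHom.id_apply]

theorem expect_apply (ψ : ι → ℂ) (M : Matrix ι ι ℂ) :
    expect ψ M = reInner ι ψ (M *ᵥ ψ) := rfl

theorem reInner_mulVec_self {M : Matrix ι ι ℂ} (hM : Mᴴ = M) (ψ : ι → ℂ) :
    reInner ι (M *ᵥ ψ) (M *ᵥ ψ) = expect ψ (M * M) := by
  rw [reInner_mulVec hM, mulVec_mulVec, expect_apply]

variable [DecidableEq ι]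

/-- Rigidity of the tilted CHSH correlations, phrased for the projections defining the
observables. -/
theorem projection_rigidity {p₀ p₁ q₀ q₁ : Matrix ι ι ℂ}
    (sp₀ : p₀ᴴ = p₀) (sp₁ : p₁ᴴ = p₁) (sq₀ : q₀ᴴ = q₀) (sq₁ : q₁ᴴ = q₁)
    (ip₀ : p₀ * p₀ = p₀) (ip₁ : p₁ * p₁ = p₁) (iq₀ : q₀ * q₀ = q₀) (iq₁ : q₁ * q₁ = q₁)
    (c₀₀ : Commute p₀ q₀) (c₀₁ : Commute p₀ q₁) (c₁₀ : Commute p₁ q₀) (c₁₁ : Commute p₁ q₁)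
    (ψ : ι → ℂ) {α γ σ S C : ℝ} (hσ : σ = γ * S) (hγ : 0 < γ) (hγσ : γ ^ 2 + σ ^ 2 = 1)
    (hS : 0 < S) (hSC : S ^ 2 + C ^ 2 = 1) (hα : 1 - C = α * S)
    (h1 : expect ψ 1 = 1)
    (h00 : 4 * expect ψ (p₀ * q₀) - 2 * expect ψ p₀ - 2 * expect ψ q₀ + 1 = γ)
    (h01 : 4 * expect ψ (p₀ * q₁) - 2 * expect ψ p₀ - 2 * expect ψ q₁ + 1 = γ)
    (h10 : 4 * expect ψ (p₁ * q₀) - 2 * expect ψ p₁ - 2 * expect ψ q₀ + 1 = S * σ)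
    (h11 : 4 * expect ψ (p₁ * q₁) - 2 * expect ψ p₁ - 2 * expect ψ q₁ + 1 = -(S * σ))
    (hb0 : 2 * expect ψ q₀ - 1 = γ * C) (hb1 : 2 * expect ψ q₁ - 1 = γ * C) :
    ((q₀ - q₁) * (q₀ - q₁)) *ᵥ (ψ - p₀ *ᵥ ψ) = σ ^ 2 • (ψ - p₀ *ᵥ ψ) ∧
    (((2 : ℝ) • p₁ - 1) * (q₀ - q₁)) *ᵥ (ψ - p₀ *ᵥ ψ) = (σ * α) • (p₀ *ᵥ ψ) := by
  let T : Matrix ι ι ℂ → (ι → ℂ) →ₗ[ℝ] (ι → ℂ) := fun p =>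
    (((2 : ℝ) • p - 1).mulVecLin).restrictScalars ℝ
  have hT : ∀ p v, T p v = ((2 : ℝ) • p - 1) *ᵥ v := fun _ _ => rfl
  have hsymm : ∀ p : Matrix ι ι ℂ, pᴴ = p → ∀ u v, reInner ι (T p u) v = reInner ι u (T p v) :=
    fun p hp u v => reInner_mulVec (by simp [hp, conjTranspose_smul]) u v
  have hinv : ∀ p : Matrix ι ι ℂ, p * p = p → ∀ v, T p (T p v) = v := fun p hp v => by
    rw [hT, hT, mulVec_mulVec]
    have : ((2 : ℝ) • p - 1) * ((2 : ℝ) • p - 1) = 1 := by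
      simp only [sub_mul, mul_sub, smul_mul_smul_comm, hp, mul_one, one_mul]
      module
    rw [this, one_mulVec]
  have hcomm : ∀ p q : Matrix ι ι ℂ, Commute p q → ∀ v, T p (T q v) = T q (T p v) :=
    fun p q h v => by
      rw [hT, hT, hT, hT, mulVec_mulVec, mulVec_mulVec]
      congr 1
      exact ((h.smul_left _).sub_left (Commute.one_left q)).smul_right _ |>.sub_right
        (Commute.one_right _)
  have hprod : ∀ p q : Matrix ι ι ℂ, reInner ι ψ (T p (T q ψ)) =
      4 * expect ψ (p * q) - 2 * expect ψ p - 2 * expect ψ q + 1 := fun p q => by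
    rw [hT, hT, mulVec_mulVec, ← expect_apply]
    have : ((2 : ℝ) • p - 1) * ((2 : ℝ) • q - 1) =
        (4 : ℝ) • (p * q) - (2 : ℝ) • p - (2 : ℝ) • q + 1 := by
      simp only [sub_mul, mul_sub, smul_mul_smul_comm, mul_one, one_mul]
      module
    rw [this]
    simp only [map_add, map_sub, map_smul, smul_eq_mul, h1]
  have hsingle : ∀ q : Matrix ι ι ℂ, reInner ι ψ (T q ψ) = 2 * expect ψ q - 1 := fun q => by
    rw [hT, ← expect_apply, map_sub, map_smul, smul_eq_mul, h1]
  have hψψ : reInner ι ψ ψ = 1 := by rw [← h1, expect_apply, one_mulVec]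
  obtain ⟨k1, k2⟩ := tilted_chsh_rigidity (reInner ι) reInner_comm reInner_self_nonneg
    (fun v => eq_zero_of_reInner_self) (T p₀) (T p₁) (T q₀) (T q₁)
    (hsymm _ sp₀) (hsymm _ sp₁) (hsymm _ sq₀) (hsymm _ sq₁)
    (hinv _ ip₀) (hinv _ ip₁) (hinv _ iq₀) (hinv _ iq₁)
    (hcomm _ _ c₀₀) (hcomm _ _ c₀₁) (hcomm _ _ c₁₀) (hcomm _ _ c₁₁)
    ψ hσ hγ hγσ hS hSC hα hψψ (by rw [hprod, h00]) (by rw [hprod, h01]) (by rw [hprod, h10])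
    (by rw [hprod, h11]) (by rw [hsingle, hb0]) (by rw [hsingle, hb1])
  have hdiff : ∀ v, (T q₀ - T q₁) v = (2 : ℝ) • ((q₀ - q₁) *ᵥ v) := fun v => by
    rw [LinearMap.sub_apply, hT, hT, ← sub_mulVec, ← smul_mulVec]
    congr 1
    module
  have hm : ψ - T p₀ ψ = (2 : ℝ) • (ψ - p₀ *ᵥ ψ) := by
    rw [hT, sub_mulVec, smul_mulVec, one_mulVec]; module
  have hp : ψ + T p₀ ψ = (2 : ℝ) • (p₀ *ᵥ ψ) := by
    rw [hT, sub_mulVec, smul_mulVec, one_mulVec]; module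
  rw [hm, hdiff, hdiff, mulVec_smul, mulVec_smul, mulVec_smul, mulVec_mulVec] at k1
  rw [hm, hp, hdiff, mulVec_smul, map_smul, map_smul, hT, mulVec_mulVec] at k2
  constructor
  · refine smul_right_injective _ (by norm_num : (8 : ℝ) ≠ 0) ?_
    simp only
    rw [show (8 : ℝ) = 2 * (2 * 2) by norm_num, mul_smul, mul_smul, k1]
    module
  · refine smul_right_injective _ (by norm_num : (4 : ℝ) ≠ 0) ?_
    simp only
    rw [show (4 : ℝ) = 2 * 2 by norm_num, mul_smul, k2]
    module

end Expectation

section Bipartite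

variable {dA dB : ℕ}

theorem actA_eq (P : Matrix (Fin dA) (Fin dA) ℂ) (ψ : Fin dA × Fin dB → ℂ) :
    actA P ψ = (P ⊗ₖ (1 : Matrix (Fin dB) (Fin dB) ℂ)) *ᵥ ψ := by
  ext ⟨i, j⟩
  simp [actA, mulVec, dotProduct, Fintype.sum_prod_type, one_apply]

theorem actB_eq (Q : Matrix (Fin dB) (Fin dB) ℂ) (ψ : Fin dA × Fin dB → ℂ) :
    actB Q ψ = ((1 : Matrix (Fin dA) (Fin dA) ℂ) ⊗ₖ Q) *ᵥ ψ := by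
  ext ⟨i, j⟩
  simp [actB, mulVec, dotProduct, Fintype.sum_prod_type, one_apply]

theorem commute_kronecker (P : Matrix (Fin dA) (Fin dA) ℂ) (Q : Matrix (Fin dB) (Fin dB) ℂ) :
    Commute (P ⊗ₖ (1 : Matrix (Fin dB) (Fin dB) ℂ)) ((1 : Matrix (Fin dA) (Fin dA) ℂ) ⊗ₖ Q) := by
  rw [commute_iff_eq, ← mul_kronecker_mul, ← mul_kronecker_mul]
  simp

theorem sub_kronecker (M N : Matrix (Fin dA) (Fin dA) ℂ) (R : Matrix (Fin dB) (Fin dB) ℂ) :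
    (M - N) ⊗ₖ R = M ⊗ₖ R - N ⊗ₖ R := by
  ext
  simp [sub_mul]

theorem kronecker_sub (R : Matrix (Fin dA) (Fin dA) ℂ) (M N : Matrix (Fin dB) (Fin dB) ℂ) :
    R ⊗ₖ (M - N) = R ⊗ₖ M - R ⊗ₖ N := by
  ext
  simp [mul_sub]

theorem re_induced (S : Strategy dA dB) (x : Fin 4) (y : Fin 5) (a b : Fin 3) :
    (induced S x y a b).re = expect S.ψ ((S.P x a ⊗ₖ 1) * (1 ⊗ₖ S.Q y b)) := by
  rw [expect_apply, ← mulVec_mulVec, ← actB_eq, ← actA_eq]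
  rfl

theorem sum_re_induced_right (S : Strategy dA dB) (x : Fin 4) (y : Fin 5) (a : Fin 3) :
    ∑ b, (induced S x y a b).re = expect S.ψ (S.P x a ⊗ₖ 1) := by
  simp only [re_induced, ← mul_kronecker_mul, mul_one, one_mul]
  rw [← map_sum, ← S.Q_complete y]
  congr 1
  ext ⟨i, j⟩ ⟨k, l⟩
  simp [Matrix.sum_apply, Finset.mul_sum]

theorem sum_re_induced_left (S : Strategy dA dB) (x : Fin 4) (y : Fin 5) (b : Fin 3) :
    ∑ a, (induced S x y a b).re = expect S.ψ (1 ⊗ₖ S.Q y b) := by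
  simp only [re_induced, ← mul_kronecker_mul, mul_one, one_mul]
  rw [← map_sum, ← S.P_complete x]
  congr 1
  ext ⟨i, j⟩ ⟨k, l⟩
  simp [Matrix.sum_apply, Finset.sum_mul]

theorem sum_sum_mul_eq_kronecker_mulVec (M : Matrix (Fin dA) (Fin dA) ℂ)
    (N : Matrix (Fin dB) (Fin dB) ℂ) (φ : Fin dA × Fin dB → ℂ) (k : Fin dA) (l : Fin dB) :
    ∑ i, ∑ j, M k i * N l j * φ (i, j) = ((M ⊗ₖ N) *ᵥ φ) (k, l) := by
  simp [mulVec, dotProduct, Fintype.sum_prod_type]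

theorem isometry_of_blocks {d : ℕ} (M : Fin 2 → Matrix (Fin d) (Fin d) ℂ)
    (hM : (M 0)ᴴ * M 0 + (M 1)ᴴ * M 1 = 1) :
    (of fun (p : Fin 2 × Fin d) i => M p.1 p.2 i)ᴴ * (of fun (p : Fin 2 × Fin d) i => M p.1 p.2 i)
      = 1 := by
  rw [← hM]
  ext i j
  simp [mul_apply, Fintype.sum_prod_type]

/-- The blocks `p` and `U (1 - p)` of a controlled unitary form an isometry. -/
theorem isometry_of_proj {d : ℕ} {p U : Matrix (Fin d) (Fin d) ℂ} (hs : pᴴ = p) (hp : p * p = p)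
    (hU : Uᴴ * U = 1) : pᴴ * p + (U * (1 - p))ᴴ * (U * (1 - p)) = 1 := by
  rw [conjTranspose_mul, conjTranspose_sub, conjTranspose_one, hs, Matrix.mul_assoc,
    ← Matrix.mul_assoc Uᴴ, hU, Matrix.one_mul, hp]
  simp [Matrix.mul_sub, Matrix.sub_mul, hp]

end Bipartite

/-- The relations satisfied by every strategy inducing the ideal correlation. -/
theorem strategy_relations {α : ℝ} (hα0 : 0 < α) (hα1 : α < 1) {dA dB : ℕ} (S : Strategy dA dB)
    (hind : ∀ x y a b, induced S x y a b = (pstar α x y a b : ℂ)) :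
    ∃ U : Matrix (Fin dB) (Fin dB) ℂ, Uᴴ * U = 1 ∧
      actB (S.Q 4 0) S.ψ = actA (S.P 0 0) S.ψ ∧
      actA (S.P 0 1) S.ψ = S.ψ - actA (S.P 0 0) S.ψ ∧
      (((2 : ℝ) • S.P 1 0 - 1) ⊗ₖ U) *ᵥ (S.ψ - actA (S.P 0 0) S.ψ) = α • actA (S.P 0 0) S.ψ ∧
      ∑ p, Complex.normSq (actA (S.P 0 0) S.ψ p) = 1 / (1 + α ^ 2) := by
  simp only [actA_eq, actB_eq]
  have hre : ∀ x y a b, (induced S x y a b).re = pstar α x y a b := fun x y a b => by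
    rw [hind, Complex.ofReal_re]
  have hE : ∀ x y a b, expect S.ψ ((S.P x a ⊗ₖ 1) * (1 ⊗ₖ S.Q y b)) = pstar α x y a b :=
    fun x y a b => by rw [← re_induced, hre]
  have hEA : ∀ x y a, expect S.ψ (S.P x a ⊗ₖ (1 : Matrix (Fin dB) (Fin dB) ℂ)) =
      pstar α x y a 0 + pstar α x y a 1 + pstar α x y a 2 := fun x y a => by
    rw [← sum_re_induced_right S x y a, Fin.sum_univ_three, hre, hre, hre]
  have hEB : ∀ x y b, expect S.ψ ((1 : Matrix (Fin dA) (Fin dA) ℂ) ⊗ₖ S.Q y b) =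
      pstar α x y 0 b + pstar α x y 1 b + pstar α x y 2 b := fun x y b => by
    rw [← sum_re_induced_left S x y b, Fin.sum_univ_three, hre, hre, hre]
  have sA : ∀ x a, (S.P x a ⊗ₖ (1 : Matrix (Fin dB) (Fin dB) ℂ))ᴴ = S.P x a ⊗ₖ 1 := fun x a => by
    rw [conjTranspose_kronecker, S.P_sa, conjTranspose_one]
  have sB : ∀ y b, ((1 : Matrix (Fin dA) (Fin dA) ℂ) ⊗ₖ S.Q y b)ᴴ = 1 ⊗ₖ S.Q y b := fun y b => by
    rw [conjTranspose_kronecker, S.Q_sa, conjTranspose_one]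
  have iA : ∀ x a, (S.P x a ⊗ₖ (1 : Matrix (Fin dB) (Fin dB) ℂ)) * (S.P x a ⊗ₖ 1) =
      S.P x a ⊗ₖ 1 := fun x a => by
    rw [← mul_kronecker_mul, S.P_proj, Matrix.one_mul]
  have iB : ∀ y b, ((1 : Matrix (Fin dA) (Fin dA) ℂ) ⊗ₖ S.Q y b) * (1 ⊗ₖ S.Q y b) =
      1 ⊗ₖ S.Q y b := fun y b => by
    rw [← mul_kronecker_mul, S.Q_proj, Matrix.one_mul]
  have h1 : expect S.ψ 1 = 1 := by
    rw [expect_apply, one_mulVec, reInner_self, S.unit]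
  obtain ⟨u00, u01, u10⟩ := pstar_zero_zero hα0 hα1
  obtain ⟨v00, v01, v10⟩ := pstar_zero_one hα0 hα1
  obtain ⟨w01, w10⟩ := pstar_one_zero hα0 hα1
  obtain ⟨x01, x10⟩ := pstar_one_one hα0 hα1
  obtain ⟨z00, z01, z10⟩ := pstar_zero_four hα0 hα1
  have l0 : ∀ y b, pstar α 0 y 2 b = 0 := fun y b => pstar_two_left α y b (.inl rfl)
  have l1 : ∀ y b, pstar α 1 y 2 b = 0 := fun y b => pstar_two_left α y b (.inr rfl)
  have r0 : ∀ x a, pstar α x 0 a 2 = 0 := fun x a => pstar_two_right α x a (.inl rfl)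
  have r1 : ∀ x a, pstar α x 1 a 2 = 0 := fun x a => pstar_two_right α x a (.inr (.inl rfl))
  have r4 : ∀ x a, pstar α x 4 a 2 = 0 := fun x a => pstar_two_right α x a (.inr (.inr rfl))
  have hden : (0 : ℝ) < 1 + α ^ 2 := by positivity
  have hsin := sin_mu_eq α
  have hcos : 0 < Real.cos (mu α) := Real.cos_arctan_pos _
  have hsq := Real.cos_sq_add_sin_sq (mu α)
  have hsin0 : 0 < Real.sin (mu α) := by rw [hsin]; positivity
  obtain ⟨k1, k2⟩ := projection_rigidity (sA 0 0) (sA 1 0) (sB 0 0) (sB 1 0)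
    (iA 0 0) (iA 1 0) (iB 0 0) (iB 1 0)
    (commute_kronecker _ _) (commute_kronecker _ _) (commute_kronecker _ _)
    (commute_kronecker _ _) S.ψ (α := α) (γ := Real.cos (mu α)) (σ := Real.sin (mu α))
    (S := 2 * α / (1 + α ^ 2)) (C := (1 - α ^ 2) / (1 + α ^ 2)) hsin hcos hsq (by positivity)
    (by field_simp; ring) (by field_simp; ring) h1
    (by rw [hE, hEA 0 0, hEB 0 0, l0, r0, u00, u01, u10]; field_simp; ring)
    (by rw [hE, hEA 0 1, hEB 0 1, l0, r1, v00, v01, v10]; field_simp; ring)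
    (by rw [hE, hEA 1 0, hEB 1 0, l1, r0, w01, w10]; field_simp; ring)
    (by rw [hE, hEA 1 1, hEB 1 1, l1, r1, x01, x10]; field_simp; ring)
    (by rw [hEB 0 0, l0, u00, u10]; field_simp; ring)
    (by rw [hEB 0 1, l0, v00, v10]; field_simp; ring)
  obtain ⟨U, G, hU, hUG⟩ := exists_sign_matrix
    ((Real.sin (mu α))⁻¹ • (S.Q 0 0 - S.Q 1 0)) (by
      rw [conjTranspose_smul, conjTranspose_sub, S.Q_sa, S.Q_sa, star_trivial])
  set ψ₁ := S.ψ - (S.P 0 0 ⊗ₖ (1 : Matrix (Fin dB) (Fin dB) ℂ)) *ᵥ S.ψ with hψ₁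
  set D : Matrix (Fin dA × Fin dB) (Fin dA × Fin dB) ℂ :=
    1 ⊗ₖ S.Q 0 0 - 1 ⊗ₖ S.Q 1 0 with hD
  have hHD : (1 : Matrix (Fin dA) (Fin dA) ℂ) ⊗ₖ ((Real.sin (mu α))⁻¹ • (S.Q 0 0 - S.Q 1 0)) =
      (Real.sin (mu α))⁻¹ • D := by
    rw [kronecker_smul, hD, kronecker_sub]
  have hUψ : ((1 : Matrix (Fin dA) (Fin dA) ℂ) ⊗ₖ U) *ᵥ ψ₁ = (Real.sin (mu α))⁻¹ • (D *ᵥ ψ₁) := by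
    have h2 : (1 : Matrix (Fin dA) (Fin dA) ℂ) ⊗ₖ U = (Real.sin (mu α))⁻¹ • D +
        (1 ⊗ₖ G) * (1 - ((Real.sin (mu α))⁻¹ • D) * ((Real.sin (mu α))⁻¹ • D)) := by
      rw [← hHD, ← mul_kronecker_mul, Matrix.one_mul,
        ← one_kronecker_one (m := Fin dA) (n := Fin dB) (α := ℂ), eq_add_of_sub_eq' hUG]
      rw [← kronecker_sub, ← mul_kronecker_mul, Matrix.one_mul, kronecker_add]
    rw [h2, add_mulVec, ← mulVec_mulVec, sub_mulVec, one_mulVec, smul_mul_smul_comm, smul_mulVec,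
      smul_mulVec, k1, smul_smul,
      show (Real.sin (mu α))⁻¹ * (Real.sin (mu α))⁻¹ * Real.sin (mu α) ^ 2 = 1 by
        field_simp, one_smul, sub_self, mulVec_zero, add_zero]
  refine ⟨U, hU, ?_, ?_, ?_, ?_⟩
  · refine sub_eq_zero.1 (eq_zero_of_reInner_self ?_)
    rw [← sub_mulVec, reInner_mulVec_self (by rw [conjTranspose_sub, sA, sB]), sub_mul, mul_sub,
      mul_sub, iA, iB, (commute_kronecker (S.P 0 0) (S.Q 4 0)).eq.symm, map_sub, map_sub, map_sub,
      hE, hEA 0 4, hEB 0 4, z01, z10, l0, r4]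
    ring
  · have h2 : (S.P 0 2 ⊗ₖ (1 : Matrix (Fin dB) (Fin dB) ℂ)) *ᵥ S.ψ = 0 := by
      refine eq_zero_of_reInner_self ?_
      rw [reInner_mulVec_self (sA 0 2), iA, hEA 0 4, l0, l0, l0]
      ring
    have h3 : (S.P 0 0 ⊗ₖ (1 : Matrix (Fin dB) (Fin dB) ℂ)) + S.P 0 1 ⊗ₖ 1 + S.P 0 2 ⊗ₖ 1 = 1 := by
      rw [← add_kronecker, ← add_kronecker, ← Fin.sum_univ_three, S.P_complete, one_kronecker_one]
    have h4 := congrArg (fun M => M *ᵥ S.ψ) h3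
    simp only [add_mulVec, h2, add_zero, one_mulVec] at h4
    exact eq_sub_of_add_eq' h4
  · have hA : ((2 : ℝ) • S.P 1 0 - 1) ⊗ₖ U =
        ((2 : ℝ) • (S.P 1 0 ⊗ₖ (1 : Matrix (Fin dB) (Fin dB) ℂ)) - 1) * (1 ⊗ₖ U) := by
      rw [sub_mul, Matrix.one_mul, smul_mul_assoc, ← mul_kronecker_mul, Matrix.one_mul,
        Matrix.mul_one, sub_kronecker, smul_kronecker]
    rw [hA, ← mulVec_mulVec, hUψ, mulVec_smul, mulVec_mulVec, k2, smul_smul]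
    congr 1
    field_simp
  · rw [← reInner_self, reInner_mulVec_self (sA 0 0), iA, hEA 0 4, z00, z01, r4]
    ring

end Sep

open Sep in
/-- first self-testing decomposition. Any finite-dimensional strategy
inducing `p*` admits local isometries `V_A, V_B` extracting the state
`(1/√(1+α²))(|00⟩ + α|11⟩) ⊗ χ`, with `(P_0^0 ⊗ I)ψ` and `(P_0^1 ⊗ I)ψ` mapped to the
corresponding components. -/
theorem first_self_testing_decomposition
    (α : ℝ) (hα0 : 0 < α) (hα1 : α < 1)
    {dA dB : ℕ} (hdA : 1 ≤ dA) (hdB : 1 ≤ dB) (S : Strategy dA dB)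
    (hind : ∀ x y a b, induced S x y a b = (pstar α x y a b : ℂ)) :
    ∃ (kA kB : ℕ), 1 ≤ kA ∧ 1 ≤ kB ∧
    ∃ (VA : Matrix (Fin 2 × Fin kA) (Fin dA) ℂ) (VB : Matrix (Fin 2 × Fin kB) (Fin dB) ℂ)
      (χ : Fin kA × Fin kB → ℂ),
      VAᴴ * VA = 1 ∧ VBᴴ * VB = 1 ∧
      (∑ p : Fin kA × Fin kB, Complex.normSq (χ p) = 1) ∧
      (∀ (s t : Fin 2) (k : Fin kA) (l : Fin kB),
        (∑ i, ∑ j, VA (s, k) i * VB (t, l) j * S.ψ (i, j))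
          = ((1 / Real.sqrt (1 + α ^ 2) : ℝ) : ℂ) *
            (if s = 0 ∧ t = 0 then 1 else if s = 1 ∧ t = 1 then (α : ℂ) else 0) * χ (k, l)) ∧
      (∀ (s t : Fin 2) (k : Fin kA) (l : Fin kB),
        (∑ i, ∑ j, VA (s, k) i * VB (t, l) j * actA (S.P 0 0) S.ψ (i, j))
          = ((1 / Real.sqrt (1 + α ^ 2) : ℝ) : ℂ) *
            (if s = 0 ∧ t = 0 then 1 else 0) * χ (k, l)) ∧
      (∀ (s t : Fin 2) (k : Fin kA) (l : Fin kB),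
        (∑ i, ∑ j, VA (s, k) i * VB (t, l) j * actA (S.P 0 1) S.ψ (i, j))
          = ((α / Real.sqrt (1 + α ^ 2) : ℝ) : ℂ) *
            (if s = 1 ∧ t = 1 then 1 else 0) * χ (k, l)) := by
  obtain ⟨U, hU, hQ, hP1, hflip, hnorm⟩ := strategy_relations hα0 hα1 S hind
  simp only [actA_eq, actB_eq] at hQ hP1 hflip hnorm
  set ψ₀ := (S.P 0 0 ⊗ₖ (1 : Matrix (Fin dB) (Fin dB) ℂ)) *ᵥ S.ψ with hψ₀
  set ψ₁ := S.ψ - ψ₀ with hψ₁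
  have hψ : S.ψ = ψ₀ + ψ₁ := by rw [hψ₁]; abel
  have hpos : (0 : ℝ) < 1 + α ^ 2 := by positivity
  have hsq : Real.sqrt (1 + α ^ 2) * Real.sqrt (1 + α ^ 2) = 1 + α ^ 2 :=
    Real.mul_self_sqrt hpos.le
  have hne : Real.sqrt (1 + α ^ 2) ≠ 0 := (Real.sqrt_pos.2 hpos).ne'
  let MA : Fin 2 → Matrix (Fin dA) (Fin dA) ℂ :=
    ![S.P 0 0, ((2 : ℝ) • S.P 1 0 - 1) * (1 - S.P 0 0)]
  let MB : Fin 2 → Matrix (Fin dB) (Fin dB) ℂ := ![S.Q 4 0, U * (1 - S.Q 4 0)]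
  have hA1 : ((2 : ℝ) • S.P 1 0 - 1)ᴴ * ((2 : ℝ) • S.P 1 0 - 1) = 1 := by
    rw [conjTranspose_sub, conjTranspose_smul, S.P_sa, conjTranspose_one, star_trivial]
    simp only [sub_mul, mul_sub, smul_mul_smul_comm, S.P_proj, mul_one, one_mul]
    module
  have hP0 : (S.P 0 0 ⊗ₖ (1 : Matrix (Fin dB) (Fin dB) ℂ)) *ᵥ ψ₀ = ψ₀ := by
    rw [hψ₀, mulVec_mulVec, ← mul_kronecker_mul, S.P_proj, Matrix.one_mul]
  have hPz : (S.P 0 0 ⊗ₖ (1 : Matrix (Fin dB) (Fin dB) ℂ)) *ᵥ ψ₁ = 0 := by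
    rw [hψ₁, mulVec_sub, hP0, hψ₀, sub_self]
  have hQ0 : ((1 : Matrix (Fin dA) (Fin dA) ℂ) ⊗ₖ S.Q 4 0) *ᵥ ψ₀ = ψ₀ := by
    rw [← hQ, mulVec_mulVec, ← mul_kronecker_mul, S.Q_proj, Matrix.one_mul]
  have hQz : ((1 : Matrix (Fin dA) (Fin dA) ℂ) ⊗ₖ S.Q 4 0) *ᵥ ψ₁ = 0 := by
    rw [hψ₁, mulVec_sub, hQ0, hQ, sub_self]
  have hPc : ∀ v, ((1 - S.P 0 0) ⊗ₖ (1 : Matrix (Fin dB) (Fin dB) ℂ)) *ᵥ v =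
      v - (S.P 0 0 ⊗ₖ (1 : Matrix (Fin dB) (Fin dB) ℂ)) *ᵥ v := fun v => by
    rw [sub_kronecker, one_kronecker_one, sub_mulVec, one_mulVec]
  have hQc : ∀ v, ((1 : Matrix (Fin dA) (Fin dA) ℂ) ⊗ₖ (1 - S.Q 4 0)) *ᵥ v =
      v - ((1 : Matrix (Fin dA) (Fin dA) ℂ) ⊗ₖ S.Q 4 0) *ᵥ v := fun v => by
    rw [kronecker_sub, one_kronecker_one, sub_mulVec, one_mulVec]
  have hsplit : ∀ (M N : Matrix (Fin dA) (Fin dA) ℂ) (M' N' : Matrix (Fin dB) (Fin dB) ℂ) v,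
      ((M * N) ⊗ₖ (M' * N')) *ᵥ v = (M ⊗ₖ M') *ᵥ ((N ⊗ₖ 1) *ᵥ ((1 ⊗ₖ N') *ᵥ v)) :=
    fun M N M' N' v => by
      rw [mulVec_mulVec, mulVec_mulVec, ← mul_kronecker_mul, ← mul_kronecker_mul, Matrix.mul_one,
        Matrix.mul_one]
  have h00 : ∀ v, (MA 0 ⊗ₖ MB 0) *ᵥ v = (S.P 0 0 ⊗ₖ 1) *ᵥ ((1 ⊗ₖ S.Q 4 0) *ᵥ v) := fun v => by
    rw [mulVec_mulVec, ← mul_kronecker_mul, Matrix.mul_one, Matrix.one_mul]; rfl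
  have h01 : ∀ v, (MA 0 ⊗ₖ MB 1) *ᵥ v =
      (1 ⊗ₖ U) *ᵥ ((S.P 0 0 ⊗ₖ 1) *ᵥ ((1 ⊗ₖ (1 - S.Q 4 0)) *ᵥ v)) := fun v => by
    rw [← hsplit, Matrix.one_mul]; rfl
  have h10 : ∀ v, (MA 1 ⊗ₖ MB 0) *ᵥ v =
      (((2 : ℝ) • S.P 1 0 - 1) ⊗ₖ 1) *ᵥ (((1 - S.P 0 0) ⊗ₖ 1) *ᵥ ((1 ⊗ₖ S.Q 4 0) *ᵥ v)) :=
    fun v => by rw [← hsplit, Matrix.one_mul]; rfl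
  have h11 : ∀ v, (MA 1 ⊗ₖ MB 1) *ᵥ v = (((2 : ℝ) • S.P 1 0 - 1) ⊗ₖ U) *ᵥ
      (((1 - S.P 0 0) ⊗ₖ 1) *ᵥ ((1 ⊗ₖ (1 - S.Q 4 0)) *ᵥ v)) := fun v => by
    rw [← hsplit]; rfl
  have hT0 : ∀ s t, (MA s ⊗ₖ MB t) *ᵥ ψ₀ = if s = 0 ∧ t = 0 then ψ₀ else 0 := by
    refine Fin.forall_fin_two.2 ⟨Fin.forall_fin_two.2 ⟨?_, ?_⟩, Fin.forall_fin_two.2 ⟨?_, ?_⟩⟩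
    · rw [if_pos ⟨rfl, rfl⟩, h00, hQ0, hP0]
    · rw [if_neg (by decide), h01, hQc, hQ0, sub_self, mulVec_zero, mulVec_zero]
    · rw [if_neg (by decide), h10, hQ0, hPc, hP0, sub_self, mulVec_zero]
    · rw [if_neg (by decide), h11, hQc, hQ0, sub_self, mulVec_zero, mulVec_zero]
  have hT1 : ∀ s t, (MA s ⊗ₖ MB t) *ᵥ ψ₁ = if s = 1 ∧ t = 1 then α • ψ₀ else 0 := by
    refine Fin.forall_fin_two.2 ⟨Fin.forall_fin_two.2 ⟨?_, ?_⟩, Fin.forall_fin_two.2 ⟨?_, ?_⟩⟩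
    · rw [if_neg (by decide), h00, hQz, mulVec_zero]
    · rw [if_neg (by decide), h01, hQc, hQz, sub_zero, hPz, mulVec_zero]
    · rw [if_neg (by decide), h10, hQz, mulVec_zero, mulVec_zero]
    · rw [if_pos ⟨rfl, rfl⟩, h11, hQc, hQz, sub_zero, hPc, hPz, sub_zero, hflip]
  have hone : ((1 / Real.sqrt (1 + α ^ 2) : ℝ) : ℂ) * (Real.sqrt (1 + α ^ 2) : ℂ) = 1 := by
    rw [← Complex.ofReal_mul, one_div_mul_cancel hne, Complex.ofReal_one]
  have hdiv : ((α / Real.sqrt (1 + α ^ 2) : ℝ) : ℂ) * (Real.sqrt (1 + α ^ 2) : ℂ) = α := by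
    rw [← Complex.ofReal_mul, div_mul_cancel₀ _ hne]
  refine ⟨dA, dB, hdA, hdB, of fun p i => MA p.1 p.2 i, of fun p i => MB p.1 p.2 i,
    fun p => (Real.sqrt (1 + α ^ 2) : ℂ) * ψ₀ p,
    isometry_of_blocks MA (isometry_of_proj (S.P_sa 0 0) (S.P_proj 0 0) hA1),
    isometry_of_blocks MB (isometry_of_proj (S.Q_sa 4 0) (S.Q_proj 4 0) hU), ?_, ?_, ?_, ?_⟩
  · simp only [map_mul, Complex.normSq_ofReal, hsq]
    rw [← Finset.mul_sum, hnorm, mul_one_div_cancel hpos.ne']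
  · intro s t k l
    simp only [of_apply]
    rw [sum_sum_mul_eq_kronecker_mulVec, hψ, mulVec_add, hT0, hT1, Pi.add_apply, mul_right_comm,
      ← mul_assoc, hone, one_mul]
    fin_cases s <;> fin_cases t <;> simp [mul_comm]
  · intro s t k l
    simp only [of_apply]
    rw [sum_sum_mul_eq_kronecker_mulVec, actA_eq, ← hψ₀, hT0, mul_right_comm,
      ← mul_assoc, hone, one_mul]
    fin_cases s <;> fin_cases t <;> simp
  · intro s t k l
    simp only [of_apply]
    rw [sum_sum_mul_eq_kronecker_mulVec, actA_eq, hP1, hT1, mul_right_comm, ← mul_assoc, hdiv]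
    fin_cases s <;> fin_cases t <;> simp
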